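/- Let A be a closed stationary dense operator on a Banach space E with nonempty resolvent set, n = n(A), and F = closure(D(A^n)). If λ ∈ ρ(A_F) (the part of A in F) and μ ∈ ρ(A), then λ − A is injective on D(A), R(λ:A_F) extends to a bounded operator on E via (μ−A)^n ∘ R(λ:A_F) ∘ R(μ:A)^n, and λ ∈ ρ(A). -/

import Mathlib

open Set

def dompowS {E : Type*} [AddCommGroup E] [Module ℂ E]
    (f : E →ₗ[ℂ] E) (D : Submodule ℂ E) : ℕ → Submodule ℂ E
  | 0 => ⊤
  | k + 1 => D ⊓ (dompowS f D k).comap f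

def statSet {E : Type*} [NormedAddCommGroup E] [Module ℂ E]
    (f : E →ₗ[ℂ] E) (D : Submodule ℂ E) : Set ℕ :=
  {k | ∀ m, k ≤ m → (dompowS f D m : Set E) ⊆ closure (dompowS f D (m + 1) : Set E)}

def IsClosedOp {E : Type*} [NormedAddCommGroup E] [Module ℂ E]
    (f : E →ₗ[ℂ] E) (D : Submodule ℂ E) : Prop :=
  IsClosed {p : E × E | p.1 ∈ D ∧ f p.1 = p.2}

def IsResolvent {E : Type*} [NormedAddCommGroup E] [NormedSpace ℂ E]
    (f : E →ₗ[ℂ] E) (D : Submodule ℂ E) (lam : ℂ) (R : E →L[ℂ] E) : Prop :=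
  (∀ x : E, R x ∈ D ∧ lam • R x - f (R x) = x) ∧
  ∀ x ∈ D, R (lam • x - f x) = x

def IsResolventPart {E : Type*} [NormedAddCommGroup E] [NormedSpace ℂ E]
    (f : E →ₗ[ℂ] E) (D F : Submodule ℂ E) (lam : ℂ) (RF : F →L[ℂ] F) : Prop :=
  (∀ y : F, ((RF y : E) ∈ D ∧ f (RF y) ∈ F) ∧ lam • (RF y : E) - f (RF y) = y) ∧
  ∀ (x : F), (x : E) ∈ D → ∀ (hfx : f x ∈ F),
    RF ⟨lam • (x : E) - f x, F.sub_mem (F.smul_mem lam x.2) hfx⟩ = x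

theorem dompowS_succ_le {E : Type*} [AddCommGroup E] [Module ℂ E]
    (f : E →ₗ[ℂ] E) (D : Submodule ℂ E) (k : ℕ) : dompowS f D (k + 1) ≤ dompowS f D k := by
  induction k with
  | zero => exact le_top
  | succ k ih => exact inf_le_inf_left D (Submodule.comap_mono ih)

theorem mem_dompowS_succ_of_smul_sub {E : Type*} [AddCommGroup E] [Module ℂ E]
    {f : E →ₗ[ℂ] E} {D : Submodule ℂ E} {c : ℂ} {z : E} (hz : z ∈ D) {k : ℕ}
    (h : c • z - f z ∈ dompowS f D k) : z ∈ dompowS f D (k + 1) := by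
  induction k with
  | zero => exact ⟨hz, trivial⟩
  | succ k ih =>
    refine ⟨hz, ?_⟩
    have hk := ih (dompowS_succ_le f D k h)
    simpa using sub_mem (Submodule.smul_mem _ c hk) h

theorem iterate_smul_sub_mem_dompowS {E : Type*} [AddCommGroup E] [Module ℂ E]
    {f : E →ₗ[ℂ] E} {D : Submodule ℂ E} (c : ℂ) (n m : ℕ) {z : E}
    (hz : z ∈ dompowS f D (m + n)) :
    (fun z => c • z - f z)^[n] z ∈ dompowS f D m := by
  induction n generalizing z with
  | zero => exact hz
  | succ n ih =>
    exact ih (sub_mem (Submodule.smul_mem _ c (dompowS_succ_le f D _ hz)) hz.2)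

theorem IsResolvent.iterate_mem_dompowS {E : Type*} [NormedAddCommGroup E] [NormedSpace ℂ E]
    {f : E →ₗ[ℂ] E} {D : Submodule ℂ E} {mu : ℂ} {R : E →L[ℂ] E} (hR : IsResolvent f D mu R)
    (n : ℕ) (x : E) : (⇑R)^[n] x ∈ dompowS f D n := by
  induction n with
  | zero => trivial
  | succ n ih =>
    rw [Function.iterate_succ_apply']
    refine mem_dompowS_succ_of_smul_sub (c := mu) (hR.1 _).1 ?_
    rwa [(hR.1 _).2]

/-- By the closed graph theorem, a linear right inverse of an injective closed operator
`lam - A` is its resolvent. -/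
theorem exists_isResolvent_of_rightInverse {E : Type*} [NormedAddCommGroup E] [NormedSpace ℂ E]
    [CompleteSpace E] {f : E →ₗ[ℂ] E} {D : Submodule ℂ E} (hA : IsClosedOp f D) {lam : ℂ}
    (hinj : ∀ x ∈ D, lam • x - f x = 0 → x = 0) (T : E →ₗ[ℂ] E)
    (hT : ∀ x, T x ∈ D ∧ lam • T x - f (T x) = x) :
    ∃ R : E →L[ℂ] E, IsResolvent f D lam R ∧ ∀ x, R x = T x := by
  have hleft : ∀ w ∈ D, T (lam • w - f w) = w := by
    intro w hw
    refine sub_eq_zero.mp (hinj _ (sub_mem (hT _).1 hw) ?_)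
    rw [smul_sub, map_sub f, sub_sub_sub_comm, (hT _).2, sub_self]
  have hgraph : IsClosed (T.graph : Set (E × E)) := by
    have hset : (T.graph : Set (E × E)) =
        (fun p : E × E => (p.2, lam • p.2 - p.1)) ⁻¹' {p : E × E | p.1 ∈ D ∧ f p.1 = p.2} := by
      ext ⟨x, w⟩
      simp only [SetLike.mem_coe, LinearMap.mem_graph_iff, mem_preimage, mem_ofPred_eq]
      constructor
      · rintro rfl
        exact ⟨(hT x).1, by rw [eq_sub_iff_add_eq, ← eq_sub_iff_add_eq', (hT x).2]⟩
      · rintro ⟨hw, hfw⟩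
        have := hleft w hw
        rwa [hfw, sub_sub_cancel, eq_comm] at this
    rw [hset]
    exact IsClosed.preimage (by fun_prop) hA
  exact ⟨ContinuousLinearMap.ofIsClosedGraph hgraph, ⟨hT, hleft⟩, fun _ => rfl⟩

/-- For a closed stationary dense operator `A` with `ρ(A) ≠ ∅`, `n = n(A)`,
`F = closure(D(Aⁿ))`: if `λ ∈ ρ(A_F)` and `μ ∈ ρ(A)`, then `λ - A` is injective on `D(A)`,
`R(μ:A)ⁿ` maps `E` into `F`, and `λ ∈ ρ(A)` with
`R(λ:A) = (μ-A)ⁿ ∘ R(λ:A_F) ∘ R(μ:A)ⁿ`. -/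
theorem stmt17 {E : Type*} [NormedAddCommGroup E] [NormedSpace ℂ E] [CompleteSpace E]
    (f : E →ₗ[ℂ] E) (D : Submodule ℂ E) (hA : IsClosedOp f D)
    (hstat : (statSet f D).Nonempty)
    (n : ℕ) (hn : n = sInf (statSet f D))
    (F : Submodule ℂ E) (hF : F = (dompowS f D n).topologicalClosure)
    (lam mu : ℂ) (RF : F →L[ℂ] F) (hRF : IsResolventPart f D F lam RF)
    (Rmu : E →L[ℂ] E) (hRmu : IsResolvent f D mu Rmu) :
    (∀ x ∈ D, lam • x - f x = 0 → x = 0) ∧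
    (∀ x : E, (⇑Rmu)^[n] x ∈ F) ∧
    ∃ R : E →L[ℂ] E, IsResolvent f D lam R ∧
      ∀ (x : E) (hx : (⇑Rmu)^[n] x ∈ F),
        R x = (fun z => mu • z - f z)^[n] ((RF ⟨(⇑Rmu)^[n] x, hx⟩ : F) : E) := by
  have hmem : ∀ x : E, (⇑Rmu)^[n] x ∈ F := fun x =>
    hF ▸ Submodule.le_topologicalClosure _ (hRmu.iterate_mem_dompowS n x)
  have hinj : ∀ x ∈ D, lam • x - f x = 0 → x = 0 := by
    intro x hx h0
    have hxF : x ∈ F := by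
      rw [hF]
      refine Submodule.le_topologicalClosure _ (dompowS_succ_le f D n ?_)
      exact mem_dompowS_succ_of_smul_sub (c := lam) hx (h0 ▸ zero_mem _)
    have hfx : f x ∈ F := by
      rw [← sub_eq_zero.mp h0]
      exact F.smul_mem lam hxF
    have h := hRF.2 ⟨x, hxF⟩ hx hfx
    simp only [h0] at h
    exact congrArg Subtype.val (h.symm.trans (map_zero RF))
  refine ⟨hinj, hmem, ?_⟩
  let g : E →ₗ[ℂ] E := mu • LinearMap.id - f
  have hg : (fun z => mu • z - f z) = ⇑g := rfl
  let S : E →ₗ[ℂ] F := ((Rmu : E →ₗ[ℂ] E) ^ n).codRestrict F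
    (fun x => by rw [Module.End.pow_apply]; exact hmem x)
  have hS : ∀ x, S x = ⟨(⇑Rmu)^[n] x, hmem x⟩ := fun x =>
    Subtype.ext (Module.End.pow_apply (Rmu : E →ₗ[ℂ] E) n x)
  let T : E →ₗ[ℂ] E := (g ^ n) ∘ₗ F.subtype ∘ₗ (RF : F →ₗ[ℂ] F) ∘ₗ S
  have hTapp : ∀ x, T x = (⇑g)^[n] (RF ⟨(⇑Rmu)^[n] x, hmem x⟩ : F) := by
    intro x
    rw [← hS, ← Module.End.pow_apply]
    rfl
  have hT : ∀ x, T x ∈ D ∧ lam • T x - f (T x) = x := by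
    intro x
    obtain ⟨⟨hD, -⟩, heq⟩ := hRF.1 ⟨(⇑Rmu)^[n] x, hmem x⟩
    rw [hTapp]
    set z : E := ((RF ⟨(⇑Rmu)^[n] x, hmem x⟩ : F) : E)
    have hz : z ∈ dompowS f D (1 + n) := by
      rw [add_comm]
      refine mem_dompowS_succ_of_smul_sub (c := lam) hD ?_
      rw [heq]
      exact hRmu.iterate_mem_dompowS n x
    refine ⟨(iterate_smul_sub_mem_dompowS mu n 1 hz).1, ?_⟩
    have hcomm : Function.Commute (fun w => lam • w - f w) ⇑g := by
      intro w
      simp only [g, LinearMap.sub_apply, LinearMap.smul_apply, LinearMap.id_apply, map_sub,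
        map_smul, smul_sub, smul_comm lam mu]
    have hinv : Function.LeftInverse ⇑g ⇑Rmu := fun y => (hRmu.1 y).2
    calc lam • (⇑g)^[n] z - f ((⇑g)^[n] z) = (⇑g)^[n] (lam • z - f z) := hcomm.iterate_right n z
      _ = x := by rw [heq]; exact hinv.iterate n x
  obtain ⟨R, hR, hRT⟩ := exists_isResolvent_of_rightInverse hA hinj T hT
  exact ⟨R, hR, fun x _ => by rw [hRT, hTapp, hg]⟩
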